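/- arXiv:2203.15964 — 2 statements merged into one kernel-verified Lean document; each statement's English description precedes it below -/
import Mathlib

section
/- (Blockwise-symmetric dots on the thick strand slide through thick–solid crossings.) In R_{m+1}(Q̄_{C̃}), for every i ∈ I, every j ∈ I and every 1 ≤ d ≤ λ_k^{(j)}: (ψ_1 ψ_2 ⋯ ψ_m) E_d^{(j)}[1,…,m] E_b = E_d^{(j)}[2,…,m+1] (ψ_1 ψ_2 ⋯ ψ_m) E_b, and (ψ_m ψ_{m−1} ⋯ ψ_1) E_d^{(j)}[2,…,m+1] E_a = E_d^{(j)}[1,…,m] (ψ_m ψ_{m−1} ⋯ ψ_1) E_a, where E_d^{(j)}[p,…,q] denotes the d-th elementary symmetric polynomial in the variables x_l for l in the j-th block of the thick strand when the thick strand occupies positions p,…,q. -/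
open Classical
open scoped BigOperators

noncomputable section

/-- A Cartan datum on a finite index set `I`: a symmetric bilinear form with
`i·i ∈ 2ℤ_{>0}` and `2(i·j)/(i·i)` a nonpositive integer for `i ≠ j`. -/
structure CartanDatum (I : Type) [Fintype I] where
  form : I → I → ℤ
  symm : ∀ i j, form i j = form j i
  diag_even : ∀ i, Even (form i i)
  diag_pos : ∀ i, 0 < form i i
  off_dvd : ∀ i j, i ≠ j → form i i ∣ 2 * form i j
  off_nonpos : ∀ i j, i ≠ j → 2 * form i j ≤ 0

/-- The bilinear form of the extended Cartan datum on `Ĩ = I ⊔ Ī`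
(`Sum.inl` is `I`, `Sum.inr` is `Ī`). -/
def extForm {I : Type} [Fintype I] (C : CartanDatum I) : I ⊕ I → I ⊕ I → ℤ
  | Sum.inl i, Sum.inl j => C.form i j
  | Sum.inl i, Sum.inr j => if j = i then -(C.form i i / 2) else 0
  | Sum.inr i, Sum.inl j => if j = i then -(C.form i i / 2) else 0
  | Sum.inr i, Sum.inr j => if i = j then C.form i i else 0

/-- Generators of the KLR algebra on `n` strands labelled by `J`:
idempotents `e 𝐢`, dots `x j`, crossings `psi j` (crossing strands `j, j+1`, 0-indexed). -/
inductive KLRGen (J : Type) (n : ℕ) : Type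
  | e : (Fin n → J) → KLRGen J n
  | x : Fin n → KLRGen J n
  | psi : Fin (n - 1) → KLRGen J n

/-- The left strand position of the crossing `ψ_j`. -/
def lpos {n : ℕ} (j : Fin (n - 1)) : Fin n := Fin.castLE (n.sub_le 1) j

/-- The right strand position of the crossing `ψ_j`. -/
def rpos {n : ℕ} (j : Fin (n - 1)) : Fin n :=
  ⟨j.val + 1, by have := j.isLt; omega⟩

/-- The generator `e(𝐢)` of the free algebra. -/
def Ef (𝕜 : Type) [Field 𝕜] (J : Type) (n : ℕ) (i : Fin n → J) :
    FreeAlgebra 𝕜 (KLRGen J n) :=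
  FreeAlgebra.ι 𝕜 (KLRGen.e i)

/-- The generator `x_j` of the free algebra. -/
def Xf (𝕜 : Type) [Field 𝕜] (J : Type) (n : ℕ) (j : Fin n) :
    FreeAlgebra 𝕜 (KLRGen J n) :=
  FreeAlgebra.ι 𝕜 (KLRGen.x j)

/-- The generator `ψ_j` of the free algebra. -/
def Pf (𝕜 : Type) [Field 𝕜] (J : Type) (n : ℕ) (j : Fin (n - 1)) :
    FreeAlgebra 𝕜 (KLRGen J n) :=
  FreeAlgebra.ι 𝕜 (KLRGen.psi j)

/-- The Cartan integer `c(a,b) = 2(a·b)/(a·a)`. -/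
def cB {J : Type} (B : J → J → ℤ) (a b : J) : ℤ := 2 * B a b / B a a

/-- A bound such that any `p` with `s^{pq}(a,b) ≠ 0` satisfies `p < sBound B a b`. -/
def sBound {J : Type} (B : J → J → ℤ) (a b : J) : ℕ := (-(B a b)).toNat + 1

/-- The term `Σ_{p,q} s^{pq}(a,b) x_j^p x_{j'}^q`. -/
def psiSqS (𝕜 : Type) [Field 𝕜] (J : Type) (n : ℕ) (B : J → J → ℤ)
    (s : J → J → ℕ → ℕ → 𝕜) (a b : J) (j j' : Fin n) :
    FreeAlgebra 𝕜 (KLRGen J n) :=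
  ∑ p ∈ Finset.range (sBound B a b), ∑ q ∈ Finset.range (sBound B a b),
    s a b p q • (Xf 𝕜 J n j ^ p * Xf 𝕜 J n j' ^ q)

/-- The defining relations of the KLR algebra `R_n` associated with the form `B`
and scalar parameters `t`, `r`, `s`. -/
inductive KLRRel (𝕜 : Type) [Field 𝕜] (J : Type) [Fintype J] (n : ℕ)
    (B : J → J → ℤ) (t : J → J → 𝕜) (r : J → 𝕜) (s : J → J → ℕ → ℕ → 𝕜) :
    FreeAlgebra 𝕜 (KLRGen J n) → FreeAlgebra 𝕜 (KLRGen J n) → Prop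
  | ee (i j : Fin n → J) :
      KLRRel 𝕜 J n B t r s (Ef 𝕜 J n i * Ef 𝕜 J n j)
        (if i = j then Ef 𝕜 J n i else 0)
  | esum :
      KLRRel 𝕜 J n B t r s (∑ i : Fin n → J, Ef 𝕜 J n i) 1
  | xe (j : Fin n) (i : Fin n → J) :
      KLRRel 𝕜 J n B t r s (Xf 𝕜 J n j * Ef 𝕜 J n i) (Ef 𝕜 J n i * Xf 𝕜 J n j)
  | psie (j : Fin (n - 1)) (i : Fin n → J) :
      KLRRel 𝕜 J n B t r s (Pf 𝕜 J n j * Ef 𝕜 J n i)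
        (Ef 𝕜 J n (i ∘ Equiv.swap (lpos j) (rpos j)) * Pf 𝕜 J n j)
  | xx (j k : Fin n) :
      KLRRel 𝕜 J n B t r s (Xf 𝕜 J n j * Xf 𝕜 J n k) (Xf 𝕜 J n k * Xf 𝕜 J n j)
  | psix (j : Fin (n - 1)) (k : Fin n) (h1 : k ≠ lpos j) (h2 : k ≠ rpos j) :
      KLRRel 𝕜 J n B t r s (Pf 𝕜 J n j * Xf 𝕜 J n k) (Xf 𝕜 J n k * Pf 𝕜 J n j)
  | psipsi (j k : Fin (n - 1)) (h : (j : ℕ) + 1 < (k : ℕ)) :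
      KLRRel 𝕜 J n B t r s (Pf 𝕜 J n j * Pf 𝕜 J n k) (Pf 𝕜 J n k * Pf 𝕜 J n j)
  | dot1 (j : Fin (n - 1)) (i : Fin n → J) :
      KLRRel 𝕜 J n B t r s
        (Xf 𝕜 J n (lpos j) * Pf 𝕜 J n j * Ef 𝕜 J n i
          - Pf 𝕜 J n j * Xf 𝕜 J n (rpos j) * Ef 𝕜 J n i)
        (if i (lpos j) = i (rpos j) then r (i (lpos j)) • Ef 𝕜 J n i else 0)
  | dot2 (j : Fin (n - 1)) (i : Fin n → J) :
      KLRRel 𝕜 J n B t r s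
        (Pf 𝕜 J n j * Xf 𝕜 J n (lpos j) * Ef 𝕜 J n i
          - Xf 𝕜 J n (rpos j) * Pf 𝕜 J n j * Ef 𝕜 J n i)
        (if i (lpos j) = i (rpos j) then r (i (lpos j)) • Ef 𝕜 J n i else 0)
  | psisq (j : Fin (n - 1)) (i : Fin n → J) :
      KLRRel 𝕜 J n B t r s (Pf 𝕜 J n j * Pf 𝕜 J n j * Ef 𝕜 J n i)
        (if i (lpos j) = i (rpos j) then 0
         else if B (i (lpos j)) (i (rpos j)) = 0 then
           t (i (lpos j)) (i (rpos j)) • Ef 𝕜 J n i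
         else
           (t (i (lpos j)) (i (rpos j)) •
              (Xf 𝕜 J n (lpos j) ^ (-(cB B (i (lpos j)) (i (rpos j)))).toNat)
            + t (i (rpos j)) (i (lpos j)) •
              (Xf 𝕜 J n (rpos j) ^ (-(cB B (i (rpos j)) (i (lpos j)))).toNat)
            + psiSqS 𝕜 J n B s (i (lpos j)) (i (rpos j)) (lpos j) (rpos j))
           * Ef 𝕜 J n i)
  | braid (j k : Fin (n - 1)) (h : (j : ℕ) + 1 = (k : ℕ)) (i : Fin n → J) :
      KLRRel 𝕜 J n B t r s
        (Pf 𝕜 J n j * Pf 𝕜 J n k * Pf 𝕜 J n j * Ef 𝕜 J n i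
          - Pf 𝕜 J n k * Pf 𝕜 J n j * Pf 𝕜 J n k * Ef 𝕜 J n i)
        (if i (lpos j) = i (rpos k) ∧ cB B (i (lpos j)) (i (rpos j)) + 1 ≤ 0 then
          (r (i (lpos j)) * t (i (lpos j)) (i (rpos j))) •
            (∑ d ∈ Finset.range ((-(cB B (i (lpos j)) (i (rpos j))) - 1).toNat + 1),
              Xf 𝕜 J n (lpos j) ^ d
                * Xf 𝕜 J n (rpos k) ^ ((-(cB B (i (lpos j)) (i (rpos j))) - 1).toNat - d)
                * Ef 𝕜 J n i)
          + r (i (lpos j)) •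
            (∑ p ∈ Finset.range (sBound B (i (lpos j)) (i (rpos j))),
             ∑ q ∈ Finset.range (sBound B (i (lpos j)) (i (rpos j))),
              s (i (lpos j)) (i (rpos j)) p q •
                ∑ k1 ∈ Finset.range p,
                  Xf 𝕜 J n (lpos j) ^ k1 * Xf 𝕜 J n (rpos j) ^ q
                    * Xf 𝕜 J n (rpos k) ^ (p - 1 - k1) * Ef 𝕜 J n i)
         else 0)

/-- The KLR algebra `R_n` on `n` strands. -/
abbrev KLRAlg (𝕜 : Type) [Field 𝕜] (J : Type) [Fintype J] (n : ℕ)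
    (B : J → J → ℤ) (t : J → J → 𝕜) (r : J → 𝕜) (s : J → J → ℕ → ℕ → 𝕜) :=
  RingQuot (KLRRel 𝕜 J n B t r s)

/-- The canonical map from the free algebra to the KLR algebra. -/
def klrMk (𝕜 : Type) [Field 𝕜] (J : Type) [Fintype J] (n : ℕ)
    (B : J → J → ℤ) (t : J → J → 𝕜) (r : J → 𝕜) (s : J → J → ℕ → ℕ → 𝕜) :
    FreeAlgebra 𝕜 (KLRGen J n) →ₐ[𝕜] KLRAlg 𝕜 J n B t r s :=
  RingQuot.mkAlgHom 𝕜 (KLRRel 𝕜 J n B t r s)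

/-- The idempotent `e(𝐢)` in the KLR algebra. -/
def eQ (𝕜 : Type) [Field 𝕜] (J : Type) [Fintype J] (n : ℕ)
    (B : J → J → ℤ) (t : J → J → 𝕜) (r : J → 𝕜) (s : J → J → ℕ → ℕ → 𝕜)
    (i : Fin n → J) : KLRAlg 𝕜 J n B t r s :=
  klrMk 𝕜 J n B t r s (Ef 𝕜 J n i)

/-- The dot `x_j` in the KLR algebra. -/
def xQ (𝕜 : Type) [Field 𝕜] (J : Type) [Fintype J] (n : ℕ)
    (B : J → J → ℤ) (t : J → J → 𝕜) (r : J → 𝕜) (s : J → J → ℕ → ℕ → 𝕜)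
    (j : Fin n) : KLRAlg 𝕜 J n B t r s :=
  klrMk 𝕜 J n B t r s (Xf 𝕜 J n j)

/-- The crossing `ψ_j` in the KLR algebra. -/
def pQ (𝕜 : Type) [Field 𝕜] (J : Type) [Fintype J] (n : ℕ)
    (B : J → J → ℤ) (t : J → J → 𝕜) (r : J → 𝕜) (s : J → J → ℕ → ℕ → 𝕜)
    (j : Fin (n - 1)) : KLRAlg 𝕜 J n B t r s :=
  klrMk 𝕜 J n B t r s (Pf 𝕜 J n j)


section Extended

/-- The list of block labels of the thick strand: the label `i` appears with
multiplicity `λ^{(i)}`, in increasing order of `i`. -/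
def blockList (N : ℕ) (lam : Fin N → ℕ) : List (Fin N) :=
  (List.finRange N).flatMap (fun i => List.replicate (lam i) i)

/-- `m = Σ_i λ^{(i)}`, the total number of dashed strands of the thick strand. -/
def mTot (N : ℕ) (lam : Fin N → ℕ) : ℕ := (blockList N lam).length

/-- The block containing the strand position `l`. -/
def blockOf (N : ℕ) (lam : Fin N → ℕ) (l : Fin (mTot N lam)) : Fin N :=
  (blockList N lam).get l

/-- `psum i = Σ_{a < i} λ^{(a)}`, the starting position of the `i`-th block. -/
def psum (N : ℕ) (lam : Fin N → ℕ) (i : Fin N) : ℕ :=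
  ∑ a : Fin N, if a.val < i.val then lam a else 0

/-- The sequence `μ̄ ∈ Ī^m` listing each `ī` with multiplicity `λ^{(i)}`, in
increasing order of `i`. -/
def mubar (N : ℕ) (lam : Fin N → ℕ) : Fin (mTot N lam) → Fin N ⊕ Fin N :=
  fun l => Sum.inr (blockOf N lam l)

/-- The standard reduced word `s_1 (s_2 s_1) ⋯ (s_{a−1} ⋯ s_1)` (0-indexed) of the
longest element `w_0` of `𝔖_a`. -/
def w0Word (a : ℕ) : List ℕ :=
  (List.range a).flatMap (fun k => (List.range k).reverse)

/-- The KLR algebra `R_n(Q̄_{C̃})` of the extended Cartan datum of `C` with the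
specialized scalar parameters: `r ≡ 1`, `s ≡ 0` and `t` as given. -/
abbrev ExtKLR (𝕜 : Type) [Field 𝕜] (N : ℕ) (C : CartanDatum (Fin N))
    (t : Fin N ⊕ Fin N → Fin N ⊕ Fin N → 𝕜) (n : ℕ) :=
  KLRAlg 𝕜 (Fin N ⊕ Fin N) n (extForm C) t (fun _ => 1) (fun _ _ _ _ => 0)

/-- The dot `x_l` (0-indexed position `l`, junk value `1` if `l ≥ n`). -/
def Xn (𝕜 : Type) [Field 𝕜] (N : ℕ) (C : CartanDatum (Fin N))
    (t : Fin N ⊕ Fin N → Fin N ⊕ Fin N → 𝕜) (n : ℕ) (l : ℕ) :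
    ExtKLR 𝕜 N C t n :=
  if h : l < n then
    xQ 𝕜 (Fin N ⊕ Fin N) n (extForm C) t (fun _ => 1) (fun _ _ _ _ => 0) ⟨l, h⟩
  else 1

/-- The crossing `ψ_l` of the strands at 0-indexed positions `l, l+1`
(junk value `1` if `l ≥ n − 1`). -/
def Pn (𝕜 : Type) [Field 𝕜] (N : ℕ) (C : CartanDatum (Fin N))
    (t : Fin N ⊕ Fin N → Fin N ⊕ Fin N → 𝕜) (n : ℕ) (l : ℕ) :
    ExtKLR 𝕜 N C t n :=
  if h : l < n - 1 then
    pQ 𝕜 (Fin N ⊕ Fin N) n (extForm C) t (fun _ => 1) (fun _ _ _ _ => 0) ⟨l, h⟩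
  else 1

/-- The idempotent `e(𝐢)` of `R_n(Q̄_{C̃})`. -/
def eS (𝕜 : Type) [Field 𝕜] (N : ℕ) (C : CartanDatum (Fin N))
    (t : Fin N ⊕ Fin N → Fin N ⊕ Fin N → 𝕜) (n : ℕ)
    (i : Fin n → Fin N ⊕ Fin N) : ExtKLR 𝕜 N C t n :=
  eQ 𝕜 (Fin N ⊕ Fin N) n (extForm C) t (fun _ => 1) (fun _ _ _ _ => 0) i

/-- The nilHecke idempotent `e_a = x_1^{a−1} ⋯ x_{a−1} ψ_{w_0}` written in the
generators attached to the `a` consecutive strand positions `o, o+1, …, o+a−1`. -/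
def enAt (𝕜 : Type) [Field 𝕜] (N : ℕ) (C : CartanDatum (Fin N))
    (t : Fin N ⊕ Fin N → Fin N ⊕ Fin N → 𝕜) (n o a : ℕ) :
    ExtKLR 𝕜 N C t n :=
  (((List.range a).map (fun d => Xn 𝕜 N C t n (o + d) ^ (a - 1 - d))).prod) *
  (((w0Word a).map (fun l => Pn 𝕜 N C t n (o + l))).prod)

/-- The product `Π_{i ∈ I} e_{λ^{(i)}}` of nilHecke idempotents, the `i`-th one
written in the generators of the `i`-th block of strand positions, the thick
strand occupying the positions `o, o+1, …, o+m−1`. -/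
def nilProd (𝕜 : Type) [Field 𝕜] (N : ℕ) (C : CartanDatum (Fin N))
    (t : Fin N ⊕ Fin N → Fin N ⊕ Fin N → 𝕜) (lam : Fin N → ℕ) (n o : ℕ) :
    ExtKLR 𝕜 N C t n :=
  ((List.finRange N).map (fun i => enAt 𝕜 N C t n (o + psum N lam i) (lam i))).prod

/-- The thick idempotent `e_{λ} = e(μ̄) Π_i e_{λ^{(i)}} ∈ R_m(Q̄_{C̃})`. -/
def thickE (𝕜 : Type) [Field 𝕜] (N : ℕ) (C : CartanDatum (Fin N))
    (t : Fin N ⊕ Fin N → Fin N ⊕ Fin N → 𝕜) (lam : Fin N → ℕ) :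
    ExtKLR 𝕜 N C t (mTot N lam) :=
  eS 𝕜 N C t (mTot N lam) (mubar N lam) * nilProd 𝕜 N C t lam (mTot N lam) 0

/-- The `d`-th elementary symmetric polynomial in the dots `x_l`, `l ∈ S`. -/
def esymAt (𝕜 : Type) [Field 𝕜] (N : ℕ) (C : CartanDatum (Fin N))
    (t : Fin N ⊕ Fin N → Fin N ⊕ Fin N → 𝕜) (n d : ℕ) (S : Finset ℕ) :
    ExtKLR 𝕜 N C t n :=
  ∑ T ∈ S.powersetCard d, ((T.sort (· ≤ ·)).map (Xn 𝕜 N C t n)).prod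

/-- The set of strand positions of the `i`-th block of the thick strand, when the
thick strand occupies the positions `o, o+1, …, o+m−1`. -/
def blkSet (N : ℕ) (lam : Fin N → ℕ) (o : ℕ) (i : Fin N) : Finset ℕ :=
  Finset.Ico (o + psum N lam i) (o + psum N lam i + lam i)

end Extended


section OneSolid

variable (𝕜 : Type) [Field 𝕜] (N : ℕ) (C : CartanDatum (Fin N))
  (t : Fin N ⊕ Fin N → Fin N ⊕ Fin N → 𝕜) (lam : Fin N → ℕ)

/-- The idempotent `E_a = e((i,μ̄))·e_{λ_k}` of `R_{m+1}(Q̄_{C̃})`, the thick strand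
occupying positions `2,…,m+1` and the solid strand labelled `i` position `1`. -/
def Ea (i : Fin N) : ExtKLR 𝕜 N C t (mTot N lam + 1) :=
  eS 𝕜 N C t (mTot N lam + 1) (Fin.cons (Sum.inl i) (mubar N lam)) *
    nilProd 𝕜 N C t lam (mTot N lam + 1) 1

/-- The idempotent `E_b = e((μ̄,i))·e_{λ_k}` of `R_{m+1}(Q̄_{C̃})`, the thick strand
occupying positions `1,…,m` and the solid strand labelled `i` position `m+1`. -/
def Eb (i : Fin N) : ExtKLR 𝕜 N C t (mTot N lam + 1) :=
  eS 𝕜 N C t (mTot N lam + 1) (Fin.snoc (mubar N lam) (Sum.inl i)) *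
    nilProd 𝕜 N C t lam (mTot N lam + 1) 0

/-- The product of crossings `ψ_1 ψ_2 ⋯ ψ_m` in `R_{m+1}(Q̄_{C̃})`. -/
def psiUp : ExtKLR 𝕜 N C t (mTot N lam + 1) :=
  ((List.range (mTot N lam)).map (Pn 𝕜 N C t (mTot N lam + 1))).prod

/-- The product of crossings `ψ_m ψ_{m−1} ⋯ ψ_1` in `R_{m+1}(Q̄_{C̃})`. -/
def psiDown : ExtKLR 𝕜 N C t (mTot N lam + 1) :=
  ((List.range (mTot N lam)).reverse.map (Pn 𝕜 N C t (mTot N lam + 1))).prod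

end OneSolid

theorem swap_castSucc_succAbove {m : ℕ} (p q : Fin m) :
    Equiv.swap p.castSucc p.succ (p.castSucc.succAbove q) = p.succ.succAbove q := by
  rcases lt_trichotomy q p with h | rfl | h
  · rw [Fin.succAbove_of_castSucc_lt _ _ (Fin.castSucc_lt_castSucc_iff.2 h),
      Fin.succAbove_of_castSucc_lt _ _ (Fin.castSucc_lt_succ_iff.2 h.le),
      Equiv.swap_apply_of_ne_of_ne] <;> simp [Fin.ext_iff] <;> omega
  · simp
  · rw [Fin.succAbove_of_le_castSucc _ _ (Fin.castSucc_le_castSucc_iff.2 h.le),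
      Fin.succAbove_of_le_castSucc _ _ (Fin.succ_le_castSucc_iff.2 h),
      Equiv.swap_apply_of_ne_of_ne] <;> simp [Fin.ext_iff] <;> omega

theorem insertNth_succ_comp_swap {J : Type} {m : ℕ} (p : Fin m) (a : J) (f : Fin m → J) :
    (p.succ.insertNth a f : Fin (m + 1) → J) ∘ Equiv.swap p.castSucc p.succ
      = p.castSucc.insertNth a f := by
  funext l
  refine Fin.succAboveCases p.castSucc ?_ (fun q => ?_) l
  · simp
  · rw [Function.comp_apply, swap_castSucc_succAbove, Fin.insertNth_apply_succAbove,
      Fin.insertNth_apply_succAbove]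

theorem insertNth_castSucc_comp_swap {J : Type} {m : ℕ} (p : Fin m) (a : J) (f : Fin m → J) :
    (p.castSucc.insertNth a f : Fin (m + 1) → J) ∘ Equiv.swap p.castSucc p.succ
      = p.succ.insertNth a f := by
  rw [← insertNth_succ_comp_swap, Function.comp_assoc]
  funext l
  simp

section StrandSlide

variable {𝕜 : Type} [Field 𝕜] {J : Type} [Fintype J] {n : ℕ}
  {B : J → J → ℤ} {t : J → J → 𝕜} {r : J → 𝕜} {s : J → J → ℕ → ℕ → 𝕜}

theorem xQ_mul_eQ (l : Fin n) (f : Fin n → J) :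
    xQ 𝕜 J n B t r s l * eQ 𝕜 J n B t r s f = eQ 𝕜 J n B t r s f * xQ 𝕜 J n B t r s l := by
  simpa only [xQ, pQ, eQ, klrMk, map_mul] using
    RingQuot.mkAlgHom_rel 𝕜 (KLRRel.xe (B := B) (t := t) (r := r) (s := s) l f)

theorem pQ_mul_eQ (p : Fin (n - 1)) (f : Fin n → J) :
    pQ 𝕜 J n B t r s p * eQ 𝕜 J n B t r s f
      = eQ 𝕜 J n B t r s (f ∘ Equiv.swap (lpos p) (rpos p)) * pQ 𝕜 J n B t r s p := by
  simpa only [xQ, pQ, eQ, klrMk, map_mul] using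
    RingQuot.mkAlgHom_rel 𝕜 (KLRRel.psie (B := B) (t := t) (r := r) (s := s) p f)

theorem pQ_mul_xQ_of_ne (p : Fin (n - 1)) (l : Fin n) (h1 : l ≠ lpos p) (h2 : l ≠ rpos p) :
    pQ 𝕜 J n B t r s p * xQ 𝕜 J n B t r s l = xQ 𝕜 J n B t r s l * pQ 𝕜 J n B t r s p := by
  simpa only [xQ, pQ, eQ, klrMk, map_mul] using
    RingQuot.mkAlgHom_rel 𝕜 (KLRRel.psix (B := B) (t := t) (r := r) (s := s) p l h1 h2)

theorem pQ_mul_xQ_rpos (p : Fin (n - 1)) (f : Fin n → J) (h : f (lpos p) ≠ f (rpos p)) :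
    pQ 𝕜 J n B t r s p * xQ 𝕜 J n B t r s (rpos p) * eQ 𝕜 J n B t r s f
      = xQ 𝕜 J n B t r s (lpos p) * pQ 𝕜 J n B t r s p * eQ 𝕜 J n B t r s f := by
  have key := RingQuot.mkAlgHom_rel 𝕜 (KLRRel.dot1 (B := B) (t := t) (r := r) (s := s) p f)
  rw [if_neg h, map_zero, map_sub, sub_eq_zero] at key
  simpa only [xQ, pQ, eQ, klrMk, map_mul] using key.symm

theorem pQ_mul_xQ_lpos (p : Fin (n - 1)) (f : Fin n → J) (h : f (lpos p) ≠ f (rpos p)) :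
    pQ 𝕜 J n B t r s p * xQ 𝕜 J n B t r s (lpos p) * eQ 𝕜 J n B t r s f
      = xQ 𝕜 J n B t r s (rpos p) * pQ 𝕜 J n B t r s p * eQ 𝕜 J n B t r s f := by
  have key := RingQuot.mkAlgHom_rel 𝕜 (KLRRel.dot2 (B := B) (t := t) (r := r) (s := s) p f)
  rw [if_neg h, map_zero, map_sub, sub_eq_zero] at key
  simpa only [xQ, pQ, eQ, klrMk, map_mul] using key

variable {m : ℕ}

theorem lpos_eq_castSucc (p : Fin m) : lpos (n := m + 1) p = p.castSucc := rfl

theorem rpos_eq_succ (p : Fin m) : rpos (n := m + 1) p = p.succ := rfl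

variable (B t r s) in
/-- `A` moves the strand labelled `a` from position `k'` to position `k`, and the dots on
the strands labelled by `f` slide through `A`. -/
structure DotsSlide (a : J) (f : Fin m → J) (A : KLRAlg 𝕜 J (m + 1) B t r s)
    (k k' : Fin (m + 1)) : Prop where
  mul_eQ : A * eQ 𝕜 J (m + 1) B t r s (k'.insertNth a f)
    = eQ 𝕜 J (m + 1) B t r s (k.insertNth a f) * A
  mul_xQ (l : Fin m) :
    A * xQ 𝕜 J (m + 1) B t r s (k'.succAbove l) * eQ 𝕜 J (m + 1) B t r s (k'.insertNth a f)
      = xQ 𝕜 J (m + 1) B t r s (k.succAbove l) * A * eQ 𝕜 J (m + 1) B t r s (k'.insertNth a f)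

namespace DotsSlide

variable {a : J} {f : Fin m → J} {A A' : KLRAlg 𝕜 J (m + 1) B t r s} {k k' k'' : Fin (m + 1)}

theorem one : DotsSlide B t r s a f 1 k k := ⟨by simp, by simp⟩

theorem mul (h : DotsSlide B t r s a f A k k') (h' : DotsSlide B t r s a f A' k' k'') :
    DotsSlide B t r s a f (A * A') k k'' where
  mul_eQ := by rw [mul_assoc, h'.mul_eQ, ← mul_assoc, h.mul_eQ, mul_assoc]
  mul_xQ l := by
    have e1 := h'.mul_xQ l
    have e2 := congrArg (· * A') (h.mul_xQ l)
    simp only [mul_assoc] at e1 e2 ⊢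
    rw [e1, h'.mul_eQ, e2]

theorem pQ_up (h : ∀ q, f q ≠ a) (p : Fin m) :
    DotsSlide B t r s a f (pQ 𝕜 J (m + 1) B t r s p) p.castSucc p.succ where
  mul_eQ := by
    rw [pQ_mul_eQ, lpos_eq_castSucc, rpos_eq_succ, insertNth_succ_comp_swap]
  mul_xQ l := by
    rcases lt_trichotomy l p with hl | rfl | hl
    · rw [Fin.succAbove_of_castSucc_lt _ _ (Fin.castSucc_lt_castSucc_iff.2 hl),
        Fin.succAbove_of_castSucc_lt _ _ (Fin.castSucc_lt_succ_iff.2 hl.le), pQ_mul_xQ_of_ne]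
      · simpa [lpos_eq_castSucc] using hl.ne
      · simp [rpos_eq_succ, Fin.ext_iff]; omega
    · rw [Fin.succAbove_succ_self, Fin.succAbove_castSucc_self]
      refine pQ_mul_xQ_lpos (n := m + 1) l _ ?_
      have := h l
      rw [← Fin.insertNth_apply_succAbove (α := fun _ => J) l.succ a f l,
        Fin.succAbove_succ_self] at this
      simpa [lpos_eq_castSucc, rpos_eq_succ] using this
    · rw [Fin.succAbove_of_le_castSucc _ _ (Fin.castSucc_le_castSucc_iff.2 hl.le),
        Fin.succAbove_of_le_castSucc _ _ (Fin.succ_le_castSucc_iff.2 hl), pQ_mul_xQ_of_ne]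
      · simp [lpos_eq_castSucc, Fin.ext_iff]; omega
      · simpa [rpos_eq_succ] using hl.ne'

theorem pQ_down (h : ∀ q, f q ≠ a) (p : Fin m) :
    DotsSlide B t r s a f (pQ 𝕜 J (m + 1) B t r s p) p.succ p.castSucc where
  mul_eQ := by
    rw [pQ_mul_eQ, lpos_eq_castSucc, rpos_eq_succ, insertNth_castSucc_comp_swap]
  mul_xQ l := by
    rcases lt_trichotomy l p with hl | rfl | hl
    · rw [Fin.succAbove_of_castSucc_lt _ _ (Fin.castSucc_lt_castSucc_iff.2 hl),
        Fin.succAbove_of_castSucc_lt _ _ (Fin.castSucc_lt_succ_iff.2 hl.le), pQ_mul_xQ_of_ne]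
      · simpa [lpos_eq_castSucc] using hl.ne
      · simp [rpos_eq_succ, Fin.ext_iff]; omega
    · rw [Fin.succAbove_succ_self, Fin.succAbove_castSucc_self]
      refine pQ_mul_xQ_rpos (n := m + 1) l _ ?_
      have := (h l).symm
      rw [← Fin.insertNth_apply_succAbove (α := fun _ => J) l.castSucc a f l,
        Fin.succAbove_castSucc_self] at this
      simpa [lpos_eq_castSucc, rpos_eq_succ] using this
    · rw [Fin.succAbove_of_le_castSucc _ _ (Fin.castSucc_le_castSucc_iff.2 hl.le),
        Fin.succAbove_of_le_castSucc _ _ (Fin.succ_le_castSucc_iff.2 hl), pQ_mul_xQ_of_ne]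
      · simp [lpos_eq_castSucc, Fin.ext_iff]; omega
      · simpa [rpos_eq_succ] using hl.ne'

theorem mul_xQ_prod (h : DotsSlide B t r s a f A k k') (L : List (Fin m)) :
    A * (L.map fun l => xQ 𝕜 J (m + 1) B t r s (k'.succAbove l)).prod
        * eQ 𝕜 J (m + 1) B t r s (k'.insertNth a f)
      = (L.map fun l => xQ 𝕜 J (m + 1) B t r s (k.succAbove l)).prod * A
        * eQ 𝕜 J (m + 1) B t r s (k'.insertNth a f) := by
  have comm (L : List (Fin m)) :
      Commute (L.map fun l => xQ 𝕜 J (m + 1) B t r s (k'.succAbove l)).prod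
        (eQ 𝕜 J (m + 1) B t r s (k'.insertNth a f)) := by
    refine Commute.list_prod_left _ _ fun y hy => ?_
    obtain ⟨l, -, rfl⟩ := List.mem_map.1 hy
    exact xQ_mul_eQ _ _
  induction L with
  | nil => simp
  | cons l L ih =>
    simp only [List.map_cons, List.prod_cons]
    calc _ = A * xQ 𝕜 J (m + 1) B t r s (k'.succAbove l)
            * ((L.map fun l => xQ 𝕜 J (m + 1) B t r s (k'.succAbove l)).prod
              * eQ 𝕜 J (m + 1) B t r s (k'.insertNth a f)) := by simp only [mul_assoc]
      _ = _ := by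
        rw [(comm L).eq, ← mul_assoc, h.mul_xQ, mul_assoc _ _ (List.prod _), ← (comm L).eq,
          mul_assoc _ A, ← mul_assoc A, ih]
        simp only [mul_assoc]

end DotsSlide

end StrandSlide

theorem mTot_eq_sum (N : ℕ) (lam : Fin N → ℕ) : mTot N lam = ∑ a, lam a := by
  simp [mTot, blockList, List.length_flatMap, List.sum_ofFn, ← List.ofFn_eq_map]

theorem psum_add_le_mTot (N : ℕ) (lam : Fin N → ℕ) (j : Fin N) :
    psum N lam j + lam j ≤ mTot N lam := by
  have hj : lam j = ∑ a : Fin N, if a = j then lam a else 0 := by simp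
  rw [mTot_eq_sum, psum, hj, ← Finset.sum_add_distrib]
  refine Finset.sum_le_sum fun a _ => ?_
  rcases eq_or_ne a j with rfl | h
  · simp
  · simp only [h, if_false, add_zero]
    split_ifs <;> simp

theorem blkSet_one_eq_map (N : ℕ) (lam : Fin N → ℕ) (j : Fin N) :
    blkSet N lam 1 j = (blkSet N lam 0 j).map (addRightEmbedding 1) := by
  rw [blkSet, blkSet, Finset.map_add_right_Ico]
  congr 1 <;> ring

section ThickSlide

variable {𝕜 : Type} [Field 𝕜] {N : ℕ} {C : CartanDatum (Fin N)}
  {t : Fin N ⊕ Fin N → Fin N ⊕ Fin N → 𝕜} {lam : Fin N → ℕ}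

theorem Xn_of_fin {n : ℕ} (l : Fin n) :
    Xn 𝕜 N C t n l = xQ 𝕜 (Fin N ⊕ Fin N) n (extForm C) t (fun _ => 1) (fun _ _ _ _ => 0) l :=
  dif_pos l.isLt

theorem Pn_of_fin {m : ℕ} (p : Fin m) :
    Pn 𝕜 N C t (m + 1) p
      = pQ 𝕜 (Fin N ⊕ Fin N) (m + 1) (extForm C) t (fun _ => 1) (fun _ _ _ _ => 0) p :=
  dif_pos p.isLt

theorem psiUp_dotsSlide (i : Fin N) :
    DotsSlide (extForm C) t (fun _ => 1) (fun _ _ _ _ => 0) (Sum.inl i) (mubar N lam)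
      (psiUp 𝕜 N C t lam) 0 (Fin.last _) := by
  have key (k : ℕ) (hk : k < mTot N lam + 1) :
      DotsSlide (extForm C) t (fun _ => 1) (fun _ _ _ _ => 0) (Sum.inl i) (mubar N lam)
        ((List.range k).map (Pn 𝕜 N C t (mTot N lam + 1))).prod 0 ⟨k, hk⟩ := by
    induction k with
    | zero => simpa using DotsSlide.one
    | succ k ih =>
      rw [List.range_succ, List.map_append, List.prod_append, List.map_singleton,
        List.prod_singleton]
      refine (ih (by omega)).mul ?_
      rw [Pn_of_fin ⟨k, Nat.lt_of_succ_lt_succ hk⟩]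
      exact DotsSlide.pQ_up (fun q => by simp [mubar]) ⟨k, Nat.lt_of_succ_lt_succ hk⟩
  exact key _ (Nat.lt_succ_self _)

theorem psiDown_dotsSlide (i : Fin N) :
    DotsSlide (extForm C) t (fun _ => 1) (fun _ _ _ _ => 0) (Sum.inl i) (mubar N lam)
      (psiDown 𝕜 N C t lam) (Fin.last _) 0 := by
  have key (k : ℕ) (hk : k < mTot N lam + 1) :
      DotsSlide (extForm C) t (fun _ => 1) (fun _ _ _ _ => 0) (Sum.inl i) (mubar N lam)
        ((List.range k).reverse.map (Pn 𝕜 N C t (mTot N lam + 1))).prod ⟨k, hk⟩ 0 := by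
    induction k with
    | zero => simpa using DotsSlide.one
    | succ k ih =>
      rw [List.range_succ, List.reverse_append, List.reverse_singleton, List.map_append,
        List.prod_append, List.map_singleton, List.prod_singleton]
      refine DotsSlide.mul ?_ (ih (by omega))
      rw [Pn_of_fin ⟨k, Nat.lt_of_succ_lt_succ hk⟩]
      exact DotsSlide.pQ_down (fun q => by simp [mubar]) ⟨k, Nat.lt_of_succ_lt_succ hk⟩
  exact key _ (Nat.lt_succ_self _)

/-- The elementary symmetric polynomials of a block at the two positions of the thick strand,
expanded over the same monomials in the dots indexed by the dashed strands. -/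
theorem exists_esymAt_eq_sum (j : Fin N) (d : ℕ) :
    ∃ F : Finset ℕ → List (Fin (mTot N lam)),
      (esymAt 𝕜 N C t (mTot N lam + 1) d (blkSet N lam 0 j)
        = ∑ T ∈ (blkSet N lam 0 j).powersetCard d, ((F T).map fun l =>
          xQ 𝕜 (Fin N ⊕ Fin N) (mTot N lam + 1) (extForm C) t (fun _ => 1) (fun _ _ _ _ => 0)
            ((Fin.last _).succAbove l)).prod) ∧
      (esymAt 𝕜 N C t (mTot N lam + 1) d (blkSet N lam 1 j)
        = ∑ T ∈ (blkSet N lam 0 j).powersetCard d, ((F T).map fun l =>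
          xQ 𝕜 (Fin N ⊕ Fin N) (mTot N lam + 1) (extForm C) t (fun _ => 1) (fun _ _ _ _ => 0)
            ((0 : Fin (mTot N lam + 1)).succAbove l)).prod) := by
  have lift (T : Finset ℕ) : ∃ L : List (Fin (mTot N lam)),
      T ∈ (blkSet N lam 0 j).powersetCard d → L.map Fin.val = T.sort (· ≤ ·) := by
    by_cases hT : T ∈ (blkSet N lam 0 j).powersetCard d
    · have hlt : ∀ l ∈ T.sort (· ≤ ·), l < mTot N lam := fun l hl => by
        have h1 := (Finset.mem_powersetCard.1 hT).1 ((Finset.mem_sort _).1 hl)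
        have h2 := psum_add_le_mTot N lam j
        rw [blkSet, Finset.mem_Ico] at h1
        omega
      refine ⟨(T.sort (· ≤ ·)).pmap Fin.mk hlt, fun _ => ?_⟩
      simp [List.map_pmap]
    · exact ⟨[], fun h => absurd h hT⟩
  choose F hF using lift
  refine ⟨F, ?_, ?_⟩
  · refine Finset.sum_congr rfl fun T hT => ?_
    rw [← hF T hT, List.map_map]
    congr 1
    refine List.map_congr_left fun l _ => ?_
    rw [Fin.succAbove_last, ← Xn_of_fin]
    rfl
  · rw [esymAt, blkSet_one_eq_map, Finset.powersetCard_map, Finset.sum_map]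
    refine Finset.sum_congr rfl fun T hT => ?_
    rw [RelEmbedding.coe_toEmbedding, Finset.mapEmbedding_apply,
      ← Finset.map_sort (r := (· ≤ ·)) (r' := (· ≤ ·)) (f := addRightEmbedding 1) (s := T)
        (by simp), ← hF T hT, List.map_map, List.map_map]
    congr 1
    refine List.map_congr_left fun l _ => ?_
    rw [Fin.succAbove_zero, ← Xn_of_fin]
    rfl

end ThickSlide

/-- blockwise-symmetric dots on the thick strand slide through
thick–solid crossings:
`(ψ_1⋯ψ_m) E_d^{(j)}[1,…,m] E_b = E_d^{(j)}[2,…,m+1] (ψ_1⋯ψ_m) E_b` and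
`(ψ_m⋯ψ_1) E_d^{(j)}[2,…,m+1] E_a = E_d^{(j)}[1,…,m] (ψ_m⋯ψ_1) E_a`
in `R_{m+1}(Q̄_{C̃})`. -/
theorem thick_dot_slides_through_thick_crossing
    (𝕜 : Type) [Field 𝕜] (N : ℕ) (C : CartanDatum (Fin N))
    (t : Fin N ⊕ Fin N → Fin N ⊕ Fin N → 𝕜)
    (ht0 : ∀ a b, t a b ≠ 0)
    (ht1 : ∀ k : Fin N, t (Sum.inr k) (Sum.inl k) = -1)
    (ht2 : ∀ k : Fin N, t (Sum.inl k) (Sum.inr k) = 1)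
    (ht3 : ∀ a b, extForm C a b = 0 → t a b = 1)
    (ht4 : ∀ a, t a a = 1)
    (lam : Fin N → ℕ) (i j : Fin N) (d : ℕ) (hd1 : 1 ≤ d) (hd2 : d ≤ lam j) :
    (psiUp 𝕜 N C t lam * esymAt 𝕜 N C t (mTot N lam + 1) d (blkSet N lam 0 j)
          * Eb 𝕜 N C t lam i
        = esymAt 𝕜 N C t (mTot N lam + 1) d (blkSet N lam 1 j)
            * psiUp 𝕜 N C t lam * Eb 𝕜 N C t lam i) ∧
    (psiDown 𝕜 N C t lam * esymAt 𝕜 N C t (mTot N lam + 1) d (blkSet N lam 1 j)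
          * Ea 𝕜 N C t lam i
        = esymAt 𝕜 N C t (mTot N lam + 1) d (blkSet N lam 0 j)
            * psiDown 𝕜 N C t lam * Ea 𝕜 N C t lam i) := by
  obtain ⟨F, h0, h1⟩ := exists_esymAt_eq_sum (𝕜 := 𝕜) (C := C) (t := t) (lam := lam) j d
  rw [Ea, Eb, ← Fin.insertNth_last', ← Fin.insertNth_zero', h0, h1]
  constructor
  · simp only [← mul_assoc]
    congr 1
    simp only [Finset.mul_sum, Finset.sum_mul]
    exact Finset.sum_congr rfl fun T _ => (psiUp_dotsSlide i).mul_xQ_prod (F T)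
  · simp only [← mul_assoc]
    congr 1
    simp only [Finset.mul_sum, Finset.sum_mul]
    exact Finset.sum_congr rfl fun T _ => (psiDown_dotsSlide i).mul_xQ_prod (F T)

end
end

section
/- (Double crossing of a solid strand around the thick strand, solid on the right.) In R_{m+1}(Q̄_{C̃}), for every i ∈ I: (ψ_m ψ_{m−1} ⋯ ψ_1)(ψ_1 ψ_2 ⋯ ψ_m) E_b = Σ_{d_1+d_2 = λ_k^{(i)}, d_1,d_2 ≥ 0} (−1)^{d_1} E_{d_1}^{(i)}[1,…,m] x_{m+1}^{d_2} E_b, where E_{d}^{(i)}[1,…,m] denotes the d-th elementary symmetric polynomial in the variables x_l for l in the i-th block of the thick strand occupying positions 1,…,m (E_0 = 1). -/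
open Classical
open scoped BigOperators

noncomputable section

section Relations

variable {𝕜 : Type} [Field 𝕜] {N : ℕ} {C : CartanDatum (Fin N)}
  {t : Fin N ⊕ Fin N → Fin N ⊕ Fin N → 𝕜} {n : ℕ}

theorem klrMk_eq {J : Type} [Fintype J] {B : J → J → ℤ} {t : J → J → 𝕜} {r : J → 𝕜}
    {s : J → J → ℕ → ℕ → 𝕜} {a b : FreeAlgebra 𝕜 (KLRGen J n)}
    (h : KLRRel 𝕜 J n B t r s a b) :
    klrMk 𝕜 J n B t r s a = klrMk 𝕜 J n B t r s b :=
  RingQuot.mkAlgHom_rel 𝕜 h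

theorem Xn_commute_eS (l : ℕ) (c : Fin n → Fin N ⊕ Fin N) :
    Commute (Xn 𝕜 N C t n l) (eS 𝕜 N C t n c) := by
  unfold Xn
  split_ifs with h
  · exact (map_mul _ _ _).symm.trans ((klrMk_eq (KLRRel.xe (𝕜 := 𝕜) (B := extForm C) (t := t)
      (r := fun _ => 1) (s := fun _ _ _ _ => 0) ⟨l, h⟩ c)).trans (map_mul _ _ _))
  · exact Commute.one_left _

theorem Xn_commute_Xn (k l : ℕ) : Commute (Xn 𝕜 N C t n k) (Xn 𝕜 N C t n l) := by
  unfold Xn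
  split_ifs with h h'
  · exact (map_mul _ _ _).symm.trans ((klrMk_eq (KLRRel.xx (𝕜 := 𝕜) (B := extForm C) (t := t)
      (r := fun _ => 1) (s := fun _ _ _ _ => 0) ⟨k, h⟩ ⟨l, h'⟩)).trans (map_mul _ _ _))
  · exact Commute.one_right _
  · exact Commute.one_left _
  · exact Commute.one_left _

theorem Pn_commute_Xn {k l : ℕ} (h₁ : l ≠ k) (h₂ : l ≠ k + 1) :
    Commute (Pn 𝕜 N C t n k) (Xn 𝕜 N C t n l) := by
  unfold Pn Xn
  split_ifs with h h'
  · exact (map_mul _ _ _).symm.trans ((klrMk_eq (KLRRel.psix (𝕜 := 𝕜) (B := extForm C) (t := t)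
      (r := fun _ => 1) (s := fun _ _ _ _ => 0) ⟨k, h⟩ ⟨l, h'⟩
      (fun e => h₁ (congrArg Fin.val e)) (fun e => h₂ (congrArg Fin.val e)))).trans (map_mul _ _ _))
  · exact Commute.one_right _
  · exact Commute.one_left _
  · exact Commute.one_left _

theorem Pn_mul_eS {k : ℕ} (hk : k + 1 < n) (c : Fin n → Fin N ⊕ Fin N) :
    Pn 𝕜 N C t n k * eS 𝕜 N C t n c =
      eS 𝕜 N C t n (c ∘ Equiv.swap ⟨k, by omega⟩ ⟨k + 1, hk⟩) * Pn 𝕜 N C t n k := by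
  have h : k < n - 1 := by omega
  simp only [Pn, dif_pos h]
  exact (map_mul _ _ _).symm.trans ((klrMk_eq (KLRRel.psie (𝕜 := 𝕜) (B := extForm C) (t := t)
    (r := fun _ => 1) (s := fun _ _ _ _ => 0) ⟨k, h⟩ c)).trans (map_mul _ _ _))

theorem Xn_mul_Pn_mul_eS {k : ℕ} (hk : k + 1 < n) (c : Fin n → Fin N ⊕ Fin N)
    (hc : c ⟨k, by omega⟩ ≠ c ⟨k + 1, hk⟩) :
    Xn 𝕜 N C t n k * Pn 𝕜 N C t n k * eS 𝕜 N C t n c =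
      Pn 𝕜 N C t n k * Xn 𝕜 N C t n (k + 1) * eS 𝕜 N C t n c := by
  have h : k < n - 1 := by omega
  have h' : k < n := by omega
  simp only [Pn, Xn, dif_pos h, dif_pos hk, dif_pos h']
  have := klrMk_eq (KLRRel.dot1 (𝕜 := 𝕜) (B := extForm C) (t := t)
    (r := fun _ => 1) (s := fun _ _ _ _ => 0) ⟨k, h⟩ c)
  rw [if_neg (show c (lpos ⟨k, h⟩) ≠ c (rpos ⟨k, h⟩) from hc), map_sub, map_zero, sub_eq_zero,
    map_mul, map_mul, map_mul, map_mul] at this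
  exact this

theorem cB_extForm_inr_inl (i : Fin N) : cB (extForm C) (Sum.inr i) (Sum.inl i) = -1 := by
  have h := C.diag_pos i
  obtain ⟨a, ha⟩ := C.diag_even i
  simp only [cB, extForm, if_true]
  rw [show 2 * -(C.form i i / 2) = -1 * C.form i i by omega]
  exact Int.mul_ediv_cancel _ h.ne'

theorem cB_extForm_inl_inr (i : Fin N) : cB (extForm C) (Sum.inl i) (Sum.inr i) = -1 := by
  simpa only [cB, extForm, if_true] using cB_extForm_inr_inl (C := C) i

/-- Double crossing of a dashed strand labelled `j` and a solid strand labelled `i` on its right. -/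
theorem Pn_mul_Pn_mul_eS
    (ht1 : ∀ k : Fin N, t (Sum.inr k) (Sum.inl k) = -1)
    (ht2 : ∀ k : Fin N, t (Sum.inl k) (Sum.inr k) = 1)
    (ht3 : ∀ a b, extForm C a b = 0 → t a b = 1)
    {k : ℕ} (hk : k + 1 < n) (c : Fin n → Fin N ⊕ Fin N) {i j : Fin N}
    (hl : c ⟨k, by omega⟩ = Sum.inr j) (hr : c ⟨k + 1, hk⟩ = Sum.inl i) :
    Pn 𝕜 N C t n k * Pn 𝕜 N C t n k * eS 𝕜 N C t n c =
      (if j = i then Xn 𝕜 N C t n (k + 1) - Xn 𝕜 N C t n k else 1) * eS 𝕜 N C t n c := by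
  have h : k < n - 1 := by omega
  have h' : k < n := by omega
  have := klrMk_eq (KLRRel.psisq (𝕜 := 𝕜) (B := extForm C) (t := t)
    (r := fun _ => 1) (s := fun _ _ _ _ => 0) ⟨k, h⟩ c)
  have hl' : c (lpos ⟨k, h⟩) = Sum.inr j := hl
  have hr' : c (rpos ⟨k, h⟩) = Sum.inl i := hr
  simp only [hl', hr', map_mul, reduceCtorEq, if_false] at this
  simp only [Pn, Xn, dif_pos h, dif_pos hk, dif_pos h']
  refine this.trans ?_
  by_cases hji : j = i
  · subst hji
    have hB : extForm C (Sum.inr j) (Sum.inl j) ≠ 0 := by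
      have h := C.diag_pos j
      obtain ⟨a, ha⟩ := C.diag_even j
      simp only [extForm, if_true]
      omega
    rw [if_neg hB, if_pos rfl, cB_extForm_inr_inl, cB_extForm_inl_inr, ht1, ht2]
    simp only [psiSqS, zero_smul, Finset.sum_const_zero, add_zero, map_mul, map_add, neg_smul,
      one_smul, map_neg, neg_neg, Int.toNat_one, pow_one]
    rw [neg_add_eq_sub]
    rfl
  · have hB : extForm C (Sum.inr j) (Sum.inl i) = 0 := by
      simp [extForm, Ne.symm hji]
    rw [if_pos hB, if_neg hji, ht3 _ _ hB, one_smul, one_mul]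
    rfl

/-- The factor `x_k - x_l` if the dashed strand at position `l` is labelled `i`, and `1` otherwise. -/
def dashedFactor (𝕜 : Type) [Field 𝕜] (N : ℕ) (C : CartanDatum (Fin N))
    (t : Fin N ⊕ Fin N → Fin N ⊕ Fin N → 𝕜) (n : ℕ) (b : ℕ → Fin N) (i : Fin N) (k l : ℕ) :
    ExtKLR 𝕜 N C t n :=
  if b l = i then Xn 𝕜 N C t n k - Xn 𝕜 N C t n l else 1

theorem dashedFactor_commute_eS (b : ℕ → Fin N) (i : Fin N) (k l : ℕ)
    (c : Fin n → Fin N ⊕ Fin N) :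
    Commute (dashedFactor 𝕜 N C t n b i k l) (eS 𝕜 N C t n c) := by
  unfold dashedFactor
  split_ifs
  · exact (Xn_commute_eS _ _).sub_left (Xn_commute_eS _ _)
  · exact Commute.one_left _

theorem dashedFactor_commute_Xn (b : ℕ → Fin N) (i : Fin N) (k l j : ℕ) :
    Commute (dashedFactor 𝕜 N C t n b i k l) (Xn 𝕜 N C t n j) := by
  unfold dashedFactor
  split_ifs
  · exact (Xn_commute_Xn _ _).sub_left (Xn_commute_Xn _ _)
  · exact Commute.one_left _

theorem dashedFactor_commute (b : ℕ → Fin N) (i : Fin N) (k l k' l' : ℕ) :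
    Commute (dashedFactor 𝕜 N C t n b i k l) (dashedFactor 𝕜 N C t n b i k' l') := by
  conv => enter [2]; unfold dashedFactor
  split_ifs
  · exact (dashedFactor_commute_Xn _ _ _ _ _).sub_right (dashedFactor_commute_Xn _ _ _ _ _)
  · exact Commute.one_right _

theorem dashedFactor_mul_Pn_mul_eS (b : ℕ → Fin N) (i : Fin N) {k l : ℕ} (hk : k + 1 < n)
    (hl : l < k) (c : Fin n → Fin N ⊕ Fin N) (hc : c ⟨k, by omega⟩ ≠ c ⟨k + 1, hk⟩) :
    dashedFactor 𝕜 N C t n b i k l * Pn 𝕜 N C t n k * eS 𝕜 N C t n c =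
      Pn 𝕜 N C t n k * dashedFactor 𝕜 N C t n b i (k + 1) l * eS 𝕜 N C t n c := by
  unfold dashedFactor
  split_ifs
  · rw [sub_mul, mul_sub, sub_mul, sub_mul, Xn_mul_Pn_mul_eS hk c hc,
      (Pn_commute_Xn (by omega) (by omega) : Commute _ (Xn 𝕜 N C t n l)).eq]
  · rw [one_mul, mul_one]

theorem prod_dashedFactor_mul_Pn_mul_eS (b : ℕ → Fin N) (i : Fin N) {k : ℕ} (hk : k + 1 < n)
    (c : Fin n → Fin N ⊕ Fin N) (hc : c ⟨k, by omega⟩ ≠ c ⟨k + 1, hk⟩)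
    (L : List ℕ) (hL : ∀ l ∈ L, l < k) :
    (L.map (dashedFactor 𝕜 N C t n b i k)).prod * Pn 𝕜 N C t n k * eS 𝕜 N C t n c =
      Pn 𝕜 N C t n k * (L.map (dashedFactor 𝕜 N C t n b i (k + 1))).prod * eS 𝕜 N C t n c := by
  induction L with
  | nil => simp
  | cons l L ih =>
    have hcomm : Commute (L.map (dashedFactor 𝕜 N C t n b i (k + 1))).prod (eS 𝕜 N C t n c) := by
      refine Commute.list_prod_left _ _ fun y hy => ?_
      obtain ⟨a, -, rfl⟩ := List.mem_map.1 hy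
      exact dashedFactor_commute_eS _ _ _ _ _
    have hl := dashedFactor_mul_Pn_mul_eS (𝕜 := 𝕜) (C := C) (t := t) b i hk
      (hL l (by simp)) c hc
    simp only [List.map_cons, List.prod_cons]
    rw [mul_assoc, mul_assoc, ← mul_assoc _ (Pn 𝕜 N C t n k),
      ih fun a ha => hL a (by simp [ha]), mul_assoc, hcomm.eq, ← mul_assoc, ← mul_assoc, hl]
    simp only [mul_assoc, hcomm.eq]

/-- Pulling a solid strand at position `k` to the left through `k` dashed strands and back. -/
theorem double_crossing_dashed_strands
    (ht1 : ∀ k : Fin N, t (Sum.inr k) (Sum.inl k) = -1)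
    (ht2 : ∀ k : Fin N, t (Sum.inl k) (Sum.inr k) = 1)
    (ht3 : ∀ a b, extForm C a b = 0 → t a b = 1)
    (b : ℕ → Fin N) (i : Fin N) (k : ℕ) (hk : k < n) (c : Fin n → Fin N ⊕ Fin N)
    (hs : c ⟨k, hk⟩ = Sum.inl i)
    (hd : ∀ (l : ℕ) (hl : l < k), c ⟨l, hl.trans hk⟩ = Sum.inr (b l)) :
    ((List.range k).reverse.map (Pn 𝕜 N C t n)).prod * ((List.range k).map (Pn 𝕜 N C t n)).prod
        * eS 𝕜 N C t n c =
      ((List.range k).map (dashedFactor 𝕜 N C t n b i k)).prod * eS 𝕜 N C t n c := by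
  induction k generalizing c with
  | zero => simp
  | succ k ih =>
    have hk' : k < n := by omega
    have hdk := hd k (by omega)
    have ih' := ih hk' (c ∘ Equiv.swap ⟨k, hk'⟩ ⟨k + 1, hk⟩) (by simpa using hs) (by
      intro l hl
      rw [Function.comp_apply, Equiv.swap_apply_of_ne_of_ne, hd l (by omega)] <;>
        simp only [ne_eq, Fin.mk.injEq] <;> omega)
    have hcomm : Commute (dashedFactor 𝕜 N C t n b i (k + 1) k)
        ((List.range k).map (dashedFactor 𝕜 N C t n b i (k + 1))).prod := by
      refine Commute.list_prod_right _ _ fun y hy => ?_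
      obtain ⟨a, -, rfl⟩ := List.mem_map.1 hy
      exact dashedFactor_commute _ _ _ _ _ _
    have hcomm' : Commute ((List.range k).map (dashedFactor 𝕜 N C t n b i (k + 1))).prod
        (eS 𝕜 N C t n c) := by
      refine Commute.list_prod_left _ _ fun y hy => ?_
      obtain ⟨a, -, rfl⟩ := List.mem_map.1 hy
      exact dashedFactor_commute_eS _ _ _ _ _
    have hsq : Pn 𝕜 N C t n k * Pn 𝕜 N C t n k * eS 𝕜 N C t n c =
        dashedFactor 𝕜 N C t n b i (k + 1) k * eS 𝕜 N C t n c :=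
      Pn_mul_Pn_mul_eS ht1 ht2 ht3 hk c hdk hs
    have hpull := prod_dashedFactor_mul_Pn_mul_eS (𝕜 := 𝕜) (C := C) (t := t) b i hk c
      (by rw [hdk, hs]; exact Sum.inr_ne_inl) (List.range k) (fun l hl => List.mem_range.1 hl)
    have hpsi := Pn_mul_eS (𝕜 := 𝕜) (C := C) (t := t) hk c
    simp only [List.range_succ, List.reverse_append, List.reverse_singleton, List.map_append,
      List.map_cons, List.map_nil, List.prod_append, List.prod_cons, List.prod_nil, mul_one,
      List.singleton_append]
    generalize ((List.range k).map (dashedFactor 𝕜 N C t n b i (k + 1))).prod = Q' at *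
    generalize ((List.range k).map (dashedFactor 𝕜 N C t n b i k)).prod = Q at *
    generalize ((List.range k).map (Pn 𝕜 N C t n)).prod = U at *
    generalize ((List.range k).reverse.map (Pn 𝕜 N C t n)).prod = D at *
    generalize eS 𝕜 N C t n (c ∘ Equiv.swap ⟨k, hk'⟩ ⟨k + 1, hk⟩) = e' at *
    generalize eS 𝕜 N C t n c = e at *
    generalize Pn 𝕜 N C t n k = p at *
    calc p * D * (U * p) * e = p * (D * U) * (p * e) := by simp only [mul_assoc]
      _ = p * (D * U * e') * p := by rw [hpsi]; simp only [mul_assoc]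
      _ = p * Q * (e' * p) := by rw [ih']; simp only [mul_assoc]
      _ = p * (Q * p * e) := by rw [← hpsi]; simp only [mul_assoc]
      _ = p * p * (Q' * e) := by rw [hpull]; simp only [mul_assoc]
      _ = p * p * e * Q' := by rw [hcomm'.eq, ← mul_assoc]
      _ = _ := by rw [hsq, mul_assoc, ← hcomm'.eq, ← mul_assoc, hcomm.eq]

end Relations

/-- Expansion of `∏ (y - x_l)` over a finite set in elementary symmetric polynomials. -/
theorem prod_sub_eq_sum_esymm {R : Type*} [CommRing R] (X : ℕ → R) (y : R) (S : Finset ℕ) :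
    ∏ l ∈ S, (y - X l) = ∑ d ∈ Finset.range (S.card + 1),
      (-1) ^ d * ((∑ T ∈ S.powersetCard d, ∏ l ∈ T, X l) * y ^ (S.card - d)) := by
  simp only [← neg_add_eq_sub]
  rw [Finset.prod_add, Finset.sum_powerset]
  refine Finset.sum_congr rfl fun d _ => ?_
  rw [Finset.sum_mul, Finset.mul_sum]
  refine Finset.sum_congr rfl fun T hT => ?_
  obtain ⟨hTS, hd⟩ := Finset.mem_powersetCard.1 hT
  rw [Finset.prod_neg, Finset.prod_const, Finset.card_sdiff_of_subset hTS, hd]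
  ring

section Symmetric

variable {𝕜 : Type} [Field 𝕜] {N : ℕ} {C : CartanDatum (Fin N)}
  {t : Fin N ⊕ Fin N → Fin N ⊕ Fin N → 𝕜} {n : ℕ}

theorem prod_dashedFactor_eq_sum_esymAt_of_lift {R : Type} [CommRing R]
    (φ : R →+* ExtKLR 𝕜 N C t n) (X : ℕ → R) (hX : ∀ l, φ (X l) = Xn 𝕜 N C t n l)
    (b : ℕ → Fin N) (i : Fin N) (m k : ℕ) :
    ((List.range m).map (dashedFactor 𝕜 N C t n b i k)).prod =
      ∑ d ∈ Finset.range (((Finset.range m).filter fun l => b l = i).card + 1), ((-1 : 𝕜) ^ d) •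
        (esymAt 𝕜 N C t n d ((Finset.range m).filter fun l => b l = i) *
          Xn 𝕜 N C t n k ^ (((Finset.range m).filter fun l => b l = i).card - d)) := by
  have hprod : ((List.range m).map (dashedFactor 𝕜 N C t n b i k)).prod =
      φ (∏ l ∈ (Finset.range m).filter (fun l => b l = i), (X k - X l)) := by
    rw [Finset.prod_filter, show ∏ l ∈ Finset.range m, (if b l = i then X k - X l else 1) =
      ((List.range m).map fun l => if b l = i then X k - X l else 1).prod from rfl,
      map_list_prod, List.map_map]
    congr 1
    refine List.map_congr_left fun l _ => ?_
    simp only [dashedFactor, Function.comp_apply, apply_ite φ, map_sub, map_one, hX]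
  have hesymm : ∀ d S, esymAt 𝕜 N C t n d S = φ (∑ T ∈ S.powersetCard d, ∏ l ∈ T, X l) := by
    intro d S
    rw [esymAt, map_sum]
    refine Finset.sum_congr rfl fun T _ => ?_
    rw [Finset.prod_eq_multiset_prod, ← Finset.sort_eq T (· ≤ ·), Multiset.map_coe,
      Multiset.prod_coe, map_list_prod, List.map_map]
    congr 1
    exact List.map_congr_left fun l _ => (hX l).symm
  rw [hprod, prod_sub_eq_sum_esymm, map_sum]
  refine Finset.sum_congr rfl fun d _ => ?_
  rw [map_mul, map_mul, hesymm, map_pow, map_pow, hX, map_neg, map_one, Algebra.smul_def, map_pow,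
    map_neg, map_one]

open scoped IsMulCommutative in
theorem prod_dashedFactor_eq_sum_esymAt (b : ℕ → Fin N) (i : Fin N) (m k : ℕ) :
    ((List.range m).map (dashedFactor 𝕜 N C t n b i k)).prod =
      ∑ d ∈ Finset.range (((Finset.range m).filter fun l => b l = i).card + 1), ((-1 : 𝕜) ^ d) •
        (esymAt 𝕜 N C t n d ((Finset.range m).filter fun l => b l = i) *
          Xn 𝕜 N C t n k ^ (((Finset.range m).filter fun l => b l = i).card - d)) := by
  have : IsMulCommutative (Algebra.adjoin 𝕜 (Set.range (Xn 𝕜 N C t n))) :=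
    Algebra.isMulCommutative_adjoin 𝕜 (by
      rintro _ ⟨k, rfl⟩ _ ⟨l, rfl⟩
      exact Xn_commute_Xn k l)
  exact prod_dashedFactor_eq_sum_esymAt_of_lift (R := Algebra.adjoin 𝕜 (Set.range (Xn 𝕜 N C t n)))
    (Algebra.adjoin 𝕜 (Set.range (Xn 𝕜 N C t n))).val.toRingHom
    (fun l => ⟨Xn 𝕜 N C t n l, Algebra.subset_adjoin ⟨l, rfl⟩⟩) (fun _ => rfl) b i m k

end Symmetric

/-- The strands labelled `i` in the thick strand are those of the `i`-th block. -/
theorem filter_blockList (N : ℕ) (lam : Fin N → ℕ) (i : Fin N) :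
    ((Finset.range (mTot N lam)).filter fun l => (blockList N lam).getD l i = i) =
      blkSet N lam 0 i := by
  obtain ⟨s, u, hsu⟩ := List.append_of_mem (List.mem_finRange i)
  have hsorted : (s ++ i :: u).Pairwise (· < ·) := hsu ▸ List.pairwise_lt_finRange N
  have hs : ∀ a ∈ s, a < i := fun a ha =>
    (List.pairwise_append.1 hsorted).2.2 a ha i (by simp)
  have hu : ∀ a ∈ u, i < a := (List.pairwise_cons.1 (List.pairwise_append.1 hsorted).2.1).1
  set f : Fin N → List (Fin N) := fun a => List.replicate (lam a) a with hf
  have hlist : blockList N lam = s.flatMap f ++ (List.replicate (lam i) i ++ u.flatMap f) := by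
    simp [blockList, hsu, hf]
  have hpsum : psum N lam i = (s.flatMap f).length := by
    rw [psum, ← List.sum_ofFn, List.ofFn_eq_map, hsu, List.length_flatMap]
    simp only [List.map_append, List.map_cons, List.sum_append, List.sum_cons, lt_irrefl, if_false,
      zero_add, hf, List.length_replicate]
    rw [List.map_congr_left (l := s) (g := lam) fun a ha => if_pos (Fin.lt_def.1 (hs a ha)),
      List.map_congr_left (l := u) (g := fun _ => 0) fun a ha => if_neg (Fin.lt_def.not.1 (hu a ha).asymm)]
    simp
  have hns : i ∉ s.flatMap f := by
    simp only [hf, List.mem_flatMap, List.mem_replicate, not_exists, not_and]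
    rintro a ha - rfl
    exact lt_irrefl _ (hs _ ha)
  have hnu : i ∉ u.flatMap f := by
    simp only [hf, List.mem_flatMap, List.mem_replicate, not_exists, not_and]
    rintro a ha - rfl
    exact lt_irrefl _ (hu _ ha)
  ext l
  simp only [Finset.mem_filter, Finset.mem_range, blkSet, Finset.mem_Ico, zero_add, mTot, hlist,
    hpsum, List.length_append, List.length_replicate]
  generalize s.flatMap f = A at *
  generalize u.flatMap f = B at *
  rcases lt_or_ge l A.length with h | h
  · rw [List.getD_append _ _ _ _ h, List.getD_eq_getElem _ _ h]
    have : A[l] ≠ i := fun e => hns (e ▸ List.getElem_mem h)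
    simp only [this, and_false, false_iff]
    omega
  · rw [List.getD_append_right _ _ _ _ h]
    rcases lt_or_ge (l - A.length) (lam i) with h' | h'
    · rw [List.getD_append _ _ _ _ (by simpa using h')]
      simp [h']
      omega
    · rw [List.getD_append_right _ _ _ _ (by simpa using h'), List.length_replicate]
      refine iff_of_false (fun ⟨h₁, h₂⟩ => ?_) (by omega)
      rw [List.getD_eq_getElem _ _ (by omega)] at h₂
      exact hnu (h₂ ▸ List.getElem_mem _)

/-- double crossing of a solid strand around the thick strand,
solid strand on the right:
`(ψ_m⋯ψ_1)(ψ_1⋯ψ_m) E_b = Σ_{d_1+d_2=λ_k^{(i)}} (−1)^{d_1} E_{d_1}^{(i)}[1,…,m] x_{m+1}^{d_2} E_b`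
in `R_{m+1}(Q̄_{C̃})`. -/
theorem double_crossing_solid_right
    (𝕜 : Type) [Field 𝕜] (N : ℕ) (C : CartanDatum (Fin N))
    (t : Fin N ⊕ Fin N → Fin N ⊕ Fin N → 𝕜)
    (ht0 : ∀ a b, t a b ≠ 0)
    (ht1 : ∀ k : Fin N, t (Sum.inr k) (Sum.inl k) = -1)
    (ht2 : ∀ k : Fin N, t (Sum.inl k) (Sum.inr k) = 1)
    (ht3 : ∀ a b, extForm C a b = 0 → t a b = 1)
    (ht4 : ∀ a, t a a = 1)
    (lam : Fin N → ℕ) (i : Fin N) :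
    psiDown 𝕜 N C t lam * psiUp 𝕜 N C t lam * Eb 𝕜 N C t lam i
      = ∑ d1 ∈ Finset.range (lam i + 1),
          ((-1 : 𝕜) ^ d1) •
            (esymAt 𝕜 N C t (mTot N lam + 1) d1 (blkSet N lam 0 i)
              * Xn 𝕜 N C t (mTot N lam + 1) (mTot N lam) ^ (lam i - d1)
              * Eb 𝕜 N C t lam i) := by
  have hcross := double_crossing_dashed_strands (𝕜 := 𝕜) (C := C) ht1 ht2 ht3
    (fun l => (blockList N lam).getD l i) i (mTot N lam) (Nat.lt_succ_self _)
    (Fin.snoc (mubar N lam) (Sum.inl i)) (Fin.snoc_last (α := fun _ => Fin N ⊕ Fin N) _ _) (by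
      intro l hl
      refine (Fin.snoc_castSucc (α := fun _ => Fin N ⊕ Fin N) _ _ (⟨l, hl⟩ : Fin (mTot N lam))).trans ?_
      rw [List.getD_eq_getElem _ _ hl]
      rfl)
  rw [prod_dashedFactor_eq_sum_esymAt, filter_blockList] at hcross
  have hcard : (blkSet N lam 0 i).card = lam i := by simp [blkSet]
  rw [hcard] at hcross
  rw [Eb, ← mul_assoc, psiDown, psiUp, hcross, Finset.sum_mul, Finset.sum_mul]
  simp only [smul_mul_assoc, mul_assoc]

end
end
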